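/- Fix a real σ > 0, an integer M ≥ 2, a desired signal amplitude μ ≥ 0, and an index j₀ ∈ {1, …, M−1}. Then the conditional correct detection probability P_c(μ, a) = ∫_0^∞ f(r; μ, σ) · ∏_{j=1}^{M−1} (1 − Q₁(a_j/σ, r/σ)) dr is strictly decreasing in the j₀-th interference amplitude: if a and a′ are vectors of nonnegative interference amplitudes that agree in every coordinate except a_{j₀} < a′_{j₀}, then P_c(μ, a′) < P_c(μ, a). -/

import Mathlib

open MeasureTheory

/-- Modified Bessel function of the first kind of order zero, via its power series. -/
noncomputable def besselI0 (x : ℝ) : ℝ :=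
  ∑' k : ℕ, (x / 2) ^ (2 * k) / ((Nat.factorial k : ℝ)) ^ 2

/-- First-order Marcum Q-function. -/
noncomputable def marcumQ1 (a b : ℝ) : ℝ :=
  ∫ x in Set.Ioi b, x * Real.exp (-(x ^ 2 + a ^ 2) / 2) * besselI0 (a * x)

/-- Rician probability density with noncentrality `μ` and scale `σ`. -/
noncomputable def ricePdf (σ μ r : ℝ) : ℝ :=
  (r / σ ^ 2) * Real.exp (-(r ^ 2 + μ ^ 2) / (2 * σ ^ 2)) * besselI0 (r * μ / σ ^ 2)

/-- Conditional correct detection probability. -/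
noncomputable def Pc (σ : ℝ) (M : ℕ) (μ : ℝ) (a : Fin (M - 1) → ℝ) : ℝ :=
  ∫ r in Set.Ioi (0 : ℝ), ricePdf σ μ r * ∏ j, (1 - marcumQ1 (a j / σ) (r / σ))

/-- The Poisson weight `e^{-t} tⁿ / n!`. -/
noncomputable def poissonWeight (n : ℕ) (t : ℝ) : ℝ :=
  Real.exp (-t) * (t ^ n / (n.factorial : ℝ))

/-- The probability that a Poisson variable of mean `t` is less than `n`. -/
noncomputable def poissonLower (n : ℕ) (t : ℝ) : ℝ :=
  ∑ k ∈ Finset.range n, poissonWeight k t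

theorem poissonWeight_nonneg (n : ℕ) {t : ℝ} (ht : 0 ≤ t) : 0 ≤ poissonWeight n t := by
  unfold poissonWeight; positivity

theorem poissonWeight_pos (n : ℕ) {t : ℝ} (ht : 0 < t) : 0 < poissonWeight n t := by
  unfold poissonWeight; positivity

theorem hasSum_poissonWeight (t : ℝ) : HasSum (fun n => poissonWeight n t) 1 := by
  have h := (NormedSpace.expSeries_div_hasSum_exp t).mul_left (Real.exp (-t))
  rwa [← Real.exp_eq_exp_ℝ, ← Real.exp_add, neg_add_cancel, Real.exp_zero] at h

theorem poissonLower_succ (n : ℕ) (t : ℝ) :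
    poissonLower (n + 1) t = poissonLower n t + poissonWeight n t :=
  Finset.sum_range_succ _ _

theorem tendsto_poissonLower (t : ℝ) :
    Filter.Tendsto (fun n => poissonLower n t) Filter.atTop (nhds 1) :=
  (hasSum_poissonWeight t).tendsto_sum_nat

theorem poissonLower_nonneg (n : ℕ) {t : ℝ} (ht : 0 ≤ t) : 0 ≤ poissonLower n t :=
  Finset.sum_nonneg fun _ _ => poissonWeight_nonneg _ ht

theorem poissonLower_le_one (n : ℕ) {t : ℝ} (ht : 0 ≤ t) : poissonLower n t ≤ 1 :=
  sum_le_hasSum _ (fun _ _ => poissonWeight_nonneg _ ht) (hasSum_poissonWeight t)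

theorem poissonLower_succ_pos (n : ℕ) {t : ℝ} (ht : 0 ≤ t) : 0 < poissonLower (n + 1) t := by
  refine Finset.sum_pos' (fun _ _ => poissonWeight_nonneg _ ht) ⟨0, by simp, ?_⟩
  simp [poissonWeight, Real.exp_pos]

theorem hasDerivAt_poissonWeight_succ (n : ℕ) (t : ℝ) :
    HasDerivAt (poissonWeight (n + 1)) (poissonWeight n t - poissonWeight (n + 1) t) t := by
  have h := (hasDerivAt_neg t).exp.mul
    ((hasDerivAt_pow (n + 1) t).div_const ((n + 1).factorial : ℝ))
  refine h.congr_deriv ?_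
  simp only [poissonWeight, Nat.factorial_succ]
  push_cast
  have := Nat.factorial_ne_zero n
  field_simp
  ring

theorem hasDerivAt_poissonLower_succ (n : ℕ) (t : ℝ) :
    HasDerivAt (poissonLower (n + 1)) (-poissonWeight n t) t := by
  induction n with
  | zero =>
    have h : poissonLower (0 + 1) = fun t => Real.exp (-t) := by
      funext s; simp [poissonLower, poissonWeight]
    rw [h]
    exact (hasDerivAt_neg t).exp.congr_deriv (by simp [poissonWeight])
  | succ n ih =>
    have h : poissonLower (n + 1 + 1) = poissonLower (n + 1) + poissonWeight (n + 1) := by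
      funext s; exact poissonLower_succ _ _
    rw [h]
    exact (ih.add (hasDerivAt_poissonWeight_succ n t)).congr_deriv (by ring)

theorem poissonLower_succ_strictAntiOn (n : ℕ) :
    StrictAntiOn (poissonLower (n + 1)) (Set.Ici 0) := by
  refine strictAntiOn_of_deriv_neg (convex_Ici 0)
    (fun t _ => (hasDerivAt_poissonLower_succ n t).continuousAt.continuousWithinAt) ?_
  intro t ht
  rw [interior_Ici] at ht
  rw [(hasDerivAt_poissonLower_succ n t).deriv]
  exact neg_neg_of_pos (poissonWeight_pos n ht)

theorem tendsto_poissonLower_atTop (n : ℕ) :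
    Filter.Tendsto (poissonLower n) Filter.atTop (nhds 0) := by
  have h : ∀ k ∈ Finset.range n, Filter.Tendsto (poissonWeight k) Filter.atTop (nhds 0) := by
    intro k _
    have := (Real.tendsto_pow_mul_exp_neg_atTop_nhds_zero k).div_const (k.factorial : ℝ)
    rw [zero_div] at this
    refine this.congr fun t => ?_
    simp only [poissonWeight]; ring
  have hsum := tendsto_finsetSum _ h
  rwa [Finset.sum_const_zero] at hsum

theorem sum_poissonWeight_mul_poissonLower (s t : ℝ) (N : ℕ) :
    ∑ k ∈ Finset.range N, poissonWeight k s * poissonLower (k + 1) t =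
      poissonLower N s * poissonLower (N + 1) t -
        ∑ k ∈ Finset.range N, poissonLower (k + 1) s * poissonWeight (k + 1) t := by
  induction N with
  | zero => simp [poissonLower]
  | succ N ih =>
    rw [Finset.sum_range_succ, Finset.sum_range_succ, ih, poissonLower_succ (N + 1) t,
      poissonLower_succ N s]
    ring

theorem summable_poissonLower_mul_poissonWeight {s t : ℝ} (hs : 0 ≤ s) (ht : 0 ≤ t) :
    Summable fun k => poissonLower (k + 1) s * poissonWeight (k + 1) t := by
  refine Summable.of_nonneg_of_le
    (fun _ => mul_nonneg (poissonLower_nonneg _ hs) (poissonWeight_nonneg _ ht))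
    (fun _ => mul_le_of_le_one_left (poissonWeight_nonneg _ ht) (poissonLower_le_one _ hs))
    ((summable_nat_add_iff 1).2 (hasSum_poissonWeight t).summable)

theorem summable_poissonWeight_mul_poissonLower {s t : ℝ} (hs : 0 ≤ s) (ht : 0 ≤ t) :
    Summable fun k => poissonWeight k s * poissonLower (k + 1) t :=
  Summable.of_nonneg_of_le
    (fun _ => mul_nonneg (poissonWeight_nonneg _ hs) (poissonLower_nonneg _ ht))
    (fun _ => mul_le_of_le_one_right (poissonWeight_nonneg _ hs) (poissonLower_le_one _ ht))
    (hasSum_poissonWeight s).summable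

theorem tsum_poissonWeight_mul_poissonLower {s t : ℝ} (hs : 0 ≤ s) (ht : 0 ≤ t) :
    ∑' k, poissonWeight k s * poissonLower (k + 1) t =
      1 - ∑' k, poissonLower (k + 1) s * poissonWeight (k + 1) t := by
  refine tendsto_nhds_unique
    (summable_poissonWeight_mul_poissonLower hs ht).hasSum.tendsto_sum_nat ?_
  simp only [sum_poissonWeight_mul_poissonLower]
  have h1 := (tendsto_poissonLower s).mul
    ((tendsto_poissonLower t).comp (Filter.tendsto_add_atTop_nat 1))
  rw [one_mul] at h1
  exact h1.sub (summable_poissonLower_mul_poissonWeight hs ht).hasSum.tendsto_sum_nat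

theorem summable_besselI0 (x : ℝ) :
    Summable fun k : ℕ => (x / 2) ^ (2 * k) / ((k.factorial : ℝ)) ^ 2 := by
  refine Summable.of_nonneg_of_le (fun k => ?_) (fun k => ?_)
    (Real.summable_pow_div_factorial ((x / 2) ^ 2))
  · rw [pow_mul]; positivity
  · rw [pow_mul]
    refine div_le_div_of_nonneg_left (by positivity) (by positivity) ?_
    exact le_self_pow₀ (by exact_mod_cast Nat.factorial_pos k) two_ne_zero

theorem besselI0_pos (x : ℝ) : 0 < besselI0 x :=
  (summable_besselI0 x).tsum_pos (fun k => by rw [pow_mul]; positivity) 0 (by simp)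

theorem rice_density_eq_tsum (a x : ℝ) :
    x * Real.exp (-(x ^ 2 + a ^ 2) / 2) * besselI0 (a * x) =
      ∑' k, poissonWeight k (a ^ 2 / 2) * (x * poissonWeight k (x ^ 2 / 2)) := by
  rw [besselI0, ← tsum_mul_left]
  refine tsum_congr fun k => ?_
  have h : Real.exp (-(x ^ 2 + a ^ 2) / 2) = Real.exp (-(a ^ 2 / 2)) * Real.exp (-(x ^ 2 / 2)) := by
    rw [← Real.exp_add]; congr 1; ring
  have h2 : (a * x / 2) ^ (2 * k) = (a ^ 2 / 2) ^ k * (x ^ 2 / 2) ^ k := by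
    rw [pow_mul, ← mul_pow]; congr 1; ring
  rw [h, h2]
  simp only [poissonWeight]
  ring

theorem hasDerivAt_neg_poissonLower_sq (k : ℕ) (x : ℝ) :
    HasDerivAt (fun x => -poissonLower (k + 1) (x ^ 2 / 2)) (x * poissonWeight k (x ^ 2 / 2)) x := by
  have h := ((hasDerivAt_poissonLower_succ k (x ^ 2 / 2)).comp x
    ((hasDerivAt_pow 2 x).div_const 2)).neg
  exact h.congr_deriv (by simp; ring)

theorem tendsto_neg_poissonLower_sq (k : ℕ) :
    Filter.Tendsto (fun x : ℝ => -poissonLower (k + 1) (x ^ 2 / 2)) Filter.atTop (nhds 0) := by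
  have h := ((tendsto_poissonLower_atTop (k + 1)).comp
    ((Filter.tendsto_pow_atTop (α := ℝ) two_ne_zero).atTop_div_const two_pos)).neg
  simpa using h

theorem integrableOn_mul_poissonWeight_sq (k : ℕ) {b : ℝ} (hb : 0 ≤ b) :
    IntegrableOn (fun x => x * poissonWeight k (x ^ 2 / 2)) (Set.Ioi b) :=
  integrableOn_Ioi_deriv_of_nonneg' (fun x _ => hasDerivAt_neg_poissonLower_sq k x)
    (fun _ hx => mul_nonneg (hb.trans (le_of_lt hx)) (poissonWeight_nonneg _ (by positivity)))
    (tendsto_neg_poissonLower_sq k)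

theorem integral_mul_poissonWeight_sq (k : ℕ) {b : ℝ} (hb : 0 ≤ b) :
    ∫ x in Set.Ioi b, x * poissonWeight k (x ^ 2 / 2) = poissonLower (k + 1) (b ^ 2 / 2) := by
  rw [integral_Ioi_of_hasDerivAt_of_nonneg' (fun x _ => hasDerivAt_neg_poissonLower_sq k x)
    (fun _ hx => mul_nonneg (hb.trans (le_of_lt hx)) (poissonWeight_nonneg _ (by positivity)))
    (tendsto_neg_poissonLower_sq k)]
  simp

theorem marcumQ1_eq_tsum (a : ℝ) {b : ℝ} (hb : 0 ≤ b) :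
    marcumQ1 a b =
      1 - ∑' k, poissonLower (k + 1) (a ^ 2 / 2) * poissonWeight (k + 1) (b ^ 2 / 2) := by
  have ha : 0 ≤ a ^ 2 / 2 := by positivity
  have hb' : 0 ≤ b ^ 2 / 2 := by positivity
  rw [← tsum_poissonWeight_mul_poissonLower ha hb', marcumQ1]
  simp only [rice_density_eq_tsum]
  rw [← integral_tsum_of_summable_integral_norm
    (fun k => (integrableOn_mul_poissonWeight_sq k hb).const_mul _)]
  · simp only [integral_const_mul, integral_mul_poissonWeight_sq _ hb]
  · refine (summable_poissonWeight_mul_poissonLower ha hb').congr fun k => ?_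
    rw [← integral_mul_poissonWeight_sq k hb, ← integral_const_mul]
    refine setIntegral_congr_fun measurableSet_Ioi fun x hx => ?_
    refine (Real.norm_of_nonneg ?_).symm
    exact mul_nonneg (poissonWeight_nonneg _ ha)
      (mul_nonneg (hb.trans (le_of_lt hx)) (poissonWeight_nonneg _ (by positivity)))

theorem integrableOn_rice_density (a : ℝ) :
    IntegrableOn (fun x => x * Real.exp (-(x ^ 2 + a ^ 2) / 2) * besselI0 (a * x))
      (Set.Ioi 0) := by
  have h : marcumQ1 a 0 = 1 := by
    rw [marcumQ1_eq_tsum a le_rfl]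
    simp [poissonWeight]
  exact Integrable.of_integral_ne_zero (by rw [← marcumQ1, h]; exact one_ne_zero)

theorem marcumQ1_antitoneOn (a : ℝ) : AntitoneOn (marcumQ1 a) (Set.Ici 0) := by
  intro b hb c _ hbc
  refine setIntegral_mono_set ((integrableOn_rice_density a).mono_set (Set.Ioi_subset_Ioi hb)) ?_
    (Set.Ioi_subset_Ioi hbc).eventuallyLE
  refine (ae_restrict_iff' measurableSet_Ioi).2 (Filter.Eventually.of_forall fun x hx => ?_)
  have : 0 ≤ x := le_trans hb (le_of_lt hx)
  have := besselI0_pos (a * x)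
  simp only [Pi.zero_apply]
  positivity

theorem marcumQ1_nonneg (a : ℝ) {b : ℝ} (hb : 0 ≤ b) : 0 ≤ marcumQ1 a b := by
  refine setIntegral_nonneg measurableSet_Ioi fun x hx => ?_
  have : 0 ≤ x := le_trans hb (le_of_lt hx)
  have := besselI0_pos (a * x)
  positivity

theorem marcumQ1_lt_one (a : ℝ) {b : ℝ} (hb : 0 < b) : marcumQ1 a b < 1 := by
  rw [marcumQ1_eq_tsum a hb.le, sub_lt_self_iff]
  have h (k : ℕ) : 0 < poissonLower (k + 1) (a ^ 2 / 2) * poissonWeight (k + 1) (b ^ 2 / 2) :=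
    mul_pos (poissonLower_succ_pos k (by positivity)) (poissonWeight_pos _ (by positivity))
  exact (summable_poissonLower_mul_poissonWeight (by positivity) (by positivity)).tsum_pos
    (fun k => (h k).le) 0 (h 0)

theorem marcumQ1_strictMono_left {a a' b : ℝ} (ha : 0 ≤ a) (h : a < a') (hb : 0 < b) :
    marcumQ1 a b < marcumQ1 a' b := by
  rw [marcumQ1_eq_tsum a hb.le, marcumQ1_eq_tsum a' hb.le, sub_lt_sub_iff_left]
  have hsq : a ^ 2 / 2 < a' ^ 2 / 2 := by gcongr
  have hlt (k : ℕ) : poissonLower (k + 1) (a' ^ 2 / 2) * poissonWeight (k + 1) (b ^ 2 / 2) <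
      poissonLower (k + 1) (a ^ 2 / 2) * poissonWeight (k + 1) (b ^ 2 / 2) :=
    mul_lt_mul_of_pos_right
      (poissonLower_succ_strictAntiOn k (Set.mem_Ici.2 (by positivity))
        (Set.mem_Ici.2 (by positivity)) hsq)
      (poissonWeight_pos _ (by positivity))
  exact Summable.tsum_lt_tsum (fun k => (hlt k).le) (hlt 0)
    (summable_poissonLower_mul_poissonWeight (by positivity) (by positivity))
    (summable_poissonLower_mul_poissonWeight (by positivity) (by positivity))

theorem ricePdf_pos {σ : ℝ} (hσ : 0 < σ) (μ : ℝ) {r : ℝ} (hr : 0 < r) : 0 < ricePdf σ μ r := by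
  have := besselI0_pos (r * μ / σ ^ 2)
  unfold ricePdf
  positivity

theorem integrableOn_ricePdf {σ : ℝ} (hσ : 0 < σ) (μ : ℝ) :
    IntegrableOn (ricePdf σ μ) (Set.Ioi 0) := by
  have h := (integrableOn_Ioi_comp_mul_right_iff _ 0 (inv_pos.2 hσ)).2
    (by rw [zero_mul]; exact integrableOn_rice_density (μ / σ))
  refine IntegrableOn.congr_fun (Integrable.const_mul h σ⁻¹) (fun r _ => ?_) measurableSet_Ioi
  have h1 : -((r * σ⁻¹) ^ 2 + (μ / σ) ^ 2) / 2 = -(r ^ 2 + μ ^ 2) / (2 * σ ^ 2) := by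
    field_simp
  have h2 : μ / σ * (r * σ⁻¹) = r * μ / σ ^ 2 := by field_simp
  simp only [h1, h2, ricePdf]
  field_simp

theorem integrableOn_Pc_integrand {σ : ℝ} (hσ : 0 < σ) (μ : ℝ) {ι : Type*} [Fintype ι]
    (a : ι → ℝ) :
    IntegrableOn (fun r => ricePdf σ μ r * ∏ j, (1 - marcumQ1 (a j / σ) (r / σ)))
      (Set.Ioi 0) := by
  refine Integrable.mul_bdd (c := 1) (integrableOn_ricePdf hσ μ) ?_ ?_
  · refine AEMeasurable.aestronglyMeasurable (Finset.aemeasurable_fun_prod _ fun j _ => ?_)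
    refine AEMeasurable.const_sub
      (aemeasurable_restrict_of_antitoneOn measurableSet_Ioi fun r hr s hs hrs => ?_) _
    exact marcumQ1_antitoneOn _ (div_nonneg (le_of_lt hr) hσ.le)
      (div_nonneg (le_of_lt hs) hσ.le) (by gcongr)
  · refine (ae_restrict_iff' measurableSet_Ioi).2 (Filter.Eventually.of_forall fun r hr => ?_)
    have hr' : 0 < r / σ := div_pos hr hσ
    rw [Real.norm_of_nonneg
      (Finset.prod_nonneg fun j _ => sub_nonneg.2 (marcumQ1_lt_one _ hr').le)]
    exact Finset.prod_le_one (fun j _ => sub_nonneg.2 (marcumQ1_lt_one _ hr').le)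
      fun j _ => sub_le_self _ (marcumQ1_nonneg _ hr'.le)

/-- The CCDP is strictly decreasing in each interference amplitude. -/
theorem Pc_strictAnti_in_interference (σ : ℝ) (hσ : 0 < σ) (M : ℕ) (hM : 2 ≤ M)
    (μ : ℝ) (hμ : 0 ≤ μ) (j₀ : Fin (M - 1))
    (a a' : Fin (M - 1) → ℝ) (ha : ∀ j, 0 ≤ a j) (ha' : ∀ j, 0 ≤ a' j)
    (hagree : ∀ j, j ≠ j₀ → a j = a' j) (hlt : a j₀ < a' j₀) :
    Pc σ M μ a' < Pc σ M μ a := by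
  have key : ∀ r ∈ Set.Ioi (0 : ℝ),
      ricePdf σ μ r * ∏ j, (1 - marcumQ1 (a' j / σ) (r / σ)) <
        ricePdf σ μ r * ∏ j, (1 - marcumQ1 (a j / σ) (r / σ)) := by
    intro r hr
    have hr' : 0 < r / σ := div_pos hr hσ
    have hj₀ : 1 - marcumQ1 (a' j₀ / σ) (r / σ) < 1 - marcumQ1 (a j₀ / σ) (r / σ) :=
      sub_lt_sub_left (marcumQ1_strictMono_left (div_nonneg (ha j₀) hσ.le)
        (by gcongr) hr') _
    refine mul_lt_mul_of_pos_left (Finset.prod_lt_prod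
      (fun j _ => sub_pos.2 (marcumQ1_lt_one _ hr')) (fun j _ => ?_)
      ⟨j₀, Finset.mem_univ _, hj₀⟩) (ricePdf_pos hσ μ hr)
    by_cases hj : j = j₀
    · exact hj ▸ hj₀.le
    · rw [hagree j hj]
  have hi := integrableOn_Pc_integrand hσ μ a
  have hi' := integrableOn_Pc_integrand hσ μ a'
  unfold Pc
  rw [← sub_pos, ← integral_sub hi hi']
  refine (setIntegral_pos_iff_support_of_nonneg_ae
    ((ae_restrict_iff' measurableSet_Ioi).2
      (Filter.Eventually.of_forall fun r hr => sub_nonneg.2 (key r hr).le)) (hi.sub hi')).2 ?_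
  rw [Set.inter_eq_right.2 fun r hr =>
    Function.mem_support.2 (sub_pos.2 (key r hr)).ne']
  simp
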